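/- Define f₁(z) = -e^{-z} · Σ_{j=1}^∞ (z^j/j!) · j·log j for z ≥ 0. Then for all z ≥ 0, -log 4 ≤ f₁''(z) < 0. -/

import Mathlib

/-- `f₁(z) = -e^{-z} ∑_{j≥1} (z^j/j!) j log j` (the `j = 0` term vanishes). -/
noncomputable def fOne (z : ℝ) : ℝ :=
  -(Real.exp (-z) * ∑' j : ℕ, z ^ j / (j.factorial : ℝ) * ((j : ℝ) * Real.log (j : ℝ)))

/-- The Poisson mean `e^{-z} ∑_j (z^j/j!) a_j` of a sequence `a`. -/
noncomputable def poissonMean (a : ℕ → ℝ) (z : ℝ) : ℝ :=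
  Real.exp (-z) * ∑' j : ℕ, z ^ j / (j.factorial : ℝ) * a j

theorem summable_pow_div_factorial_mul {a : ℕ → ℝ} {C r : ℝ}
    (ha : ∀ j, |a j| ≤ C * r ^ j) (z : ℝ) :
    Summable fun j : ℕ => z ^ j / (j.factorial : ℝ) * a j := by
  refine Summable.of_norm_bounded
    (g := fun j : ℕ => C * ((|z| * r) ^ j / (j.factorial : ℝ)))
    ((Real.summable_pow_div_factorial (|z| * r)).mul_left C) fun j => ?_
  rw [Real.norm_eq_abs, abs_mul, abs_div, abs_pow, Nat.abs_cast]
  calc |z| ^ j / (j.factorial : ℝ) * |a j|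
      ≤ |z| ^ j / (j.factorial : ℝ) * (C * r ^ j) := by gcongr; exact ha j
    _ = _ := by rw [mul_pow]; ring

theorem hasDerivAt_tsum_pow_div_factorial_mul {a : ℕ → ℝ} {C r : ℝ}
    (ha : ∀ j, |a j| ≤ C * r ^ j) (z : ℝ) :
    HasDerivAt (fun z : ℝ => ∑' j : ℕ, z ^ j / (j.factorial : ℝ) * a j)
      (∑' j : ℕ, z ^ j / (j.factorial : ℝ) * a (j + 1)) z := by
  have hshift : ∀ (y b : ℝ) (n : ℕ),
      ((n + 1 : ℕ) : ℝ) * y ^ (n + 1 - 1) / ((n + 1).factorial : ℝ) * b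
        = y ^ n / (n.factorial : ℝ) * b := by
    intro y b n
    rw [Nat.factorial_succ, Nat.add_sub_cancel]
    have := n.factorial_ne_zero
    push_cast
    field_simp
  have hsum : ∀ (b : ℕ → ℝ), (∀ j, |b j| ≤ C * r ^ j) → ∀ y : ℝ,
      Summable fun n : ℕ => (n : ℝ) * y ^ (n - 1) / (n.factorial : ℝ) * b n := by
    intro b hb y
    rw [← summable_nat_add_iff 1]
    simp only [hshift]
    refine summable_pow_div_factorial_mul (a := fun n => b (n + 1)) (C := C * r) (r := r)
      (fun j => ?_) y
    calc |b (j + 1)| ≤ C * r ^ (j + 1) := hb _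
      _ = C * r * r ^ j := by ring
  have key := hasDerivAt_tsum_of_isPreconnected
    (g := fun (n : ℕ) (y : ℝ) => y ^ n / (n.factorial : ℝ) * a n)
    (g' := fun (n : ℕ) (y : ℝ) => (n : ℝ) * y ^ (n - 1) / (n.factorial : ℝ) * a n)
    (t := Metric.ball 0 (|z| + 1)) (y₀ := 0) (y := z)
    (hsum (fun j => |a j|) (fun j => by rw [abs_abs]; exact ha j) (|z| + 1))
    Metric.isOpen_ball (convex_ball _ _).isPreconnected
    (fun n y _ => ((hasDerivAt_pow n y).div_const _).mul_const _)
    (fun n y hy => by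
      rw [mem_ball_zero_iff, Real.norm_eq_abs] at hy
      rw [Real.norm_eq_abs, abs_mul, abs_div, abs_mul, abs_pow, Nat.abs_cast, Nat.abs_cast]
      gcongr)
    (Metric.mem_ball_self (by positivity)) (summable_pow_div_factorial_mul ha 0)
    (by rw [mem_ball_zero_iff, Real.norm_eq_abs]; linarith)
  rw [(hsum a ha z).tsum_eq_zero_add] at key
  simpa only [hshift, Nat.cast_zero, zero_mul, zero_div, zero_add] using key

theorem hasDerivAt_poissonMean {a : ℕ → ℝ} {C r : ℝ}
    (ha : ∀ j, |a j| ≤ C * r ^ j) (z : ℝ) :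
    HasDerivAt (poissonMean a) (poissonMean (fun j => a (j + 1) - a j) z) z := by
  have hs : Summable fun j : ℕ => z ^ j / (j.factorial : ℝ) * a (j + 1) :=
    summable_pow_div_factorial_mul (a := fun j => a (j + 1)) (C := C * r) (r := r)
      (fun j => (ha (j + 1)).trans_eq (by ring)) z
  have h := ((hasDerivAt_neg z).exp).mul (hasDerivAt_tsum_pow_div_factorial_mul ha z)
  refine h.congr_deriv ?_
  simp only [poissonMean, mul_sub]
  rw [hs.tsum_sub (summable_pow_div_factorial_mul ha z)]
  ring

theorem abs_natCast_mul_log_le (j : ℕ) : |(j : ℝ) * Real.log j| ≤ 1 * 4 ^ j := by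
  have h1 : Real.log j ≤ j := Real.log_le_self j.cast_nonneg
  have h2 : (j : ℝ) ≤ 2 ^ j := by exact_mod_cast Nat.lt_two_pow_self.le
  rw [abs_of_nonneg (mul_nonneg j.cast_nonneg (Real.log_natCast_nonneg j))]
  calc (j : ℝ) * Real.log j ≤ 2 ^ j * 2 ^ j := by
        gcongr
        exact h1.trans h2
    _ = 1 * 4 ^ j := by rw [← mul_pow]; norm_num

/-- The second forward difference of `t ↦ t log t`. -/
noncomputable def mulLogSecondDiff (t : ℕ) : ℝ :=
  (((t + 1 + 1 : ℕ) : ℝ) * Real.log ((t + 1 + 1 : ℕ) : ℝ)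
      - ((t + 1 : ℕ) : ℝ) * Real.log ((t + 1 : ℕ) : ℝ))
    - (((t + 1 : ℕ) : ℝ) * Real.log ((t + 1 : ℕ) : ℝ) - (t : ℝ) * Real.log (t : ℝ))

theorem mulLogSecondDiff_pos (t : ℕ) : 0 < mulLogSecondDiff t := by
  have h := Real.strictConvexOn_mul_log.2 (Set.mem_Ici.2 (by positivity : (0 : ℝ) ≤ t))
    (Set.mem_Ici.2 (by positivity : (0 : ℝ) ≤ t + 2)) (by linarith)
    (by norm_num : (0 : ℝ) < 1 / 2) (by norm_num : (0 : ℝ) < 1 / 2) (by norm_num)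
  simp only [smul_eq_mul] at h
  rw [show 1 / 2 * (t : ℝ) + 1 / 2 * ((t : ℝ) + 2) = t + 1 by ring] at h
  rw [mulLogSecondDiff]
  push_cast
  rw [show (t : ℝ) + 1 + 1 = t + 2 by ring]
  linarith

theorem mulLogSecondDiff_le (t : ℕ) : mulLogSecondDiff t ≤ Real.log 4 := by
  have h4 : Real.log 4 = 2 * Real.log 2 := by
    rw [show (4 : ℝ) = 2 ^ 2 by norm_num, Real.log_pow]; norm_num
  rcases Nat.eq_zero_or_pos t with rfl | ht
  · rw [mulLogSecondDiff, h4]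
    norm_num
  · have ht1 : (1 : ℝ) ≤ t := by exact_mod_cast ht
    have hlog := Real.log_two_gt_d9
    rw [mulLogSecondDiff]
    push_cast
    generalize (t : ℝ) = x at ht1
    have hx : 0 < x := by linarith
    have h1 := Real.log_le_sub_one_of_pos (x := (x + 1 + 1) / (x + 1)) (by positivity)
    have h2 := Real.log_le_sub_one_of_pos (x := x / (x + 1)) (by positivity)
    rw [Real.log_div (by positivity) (by positivity)] at h1 h2
    have h3 := mul_le_mul_of_nonneg_left h1 (show 0 ≤ x + 1 + 1 by positivity)
    have h5 := mul_le_mul_of_nonneg_left h2 hx.le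
    have h6 : (x + 1 + 1) * ((x + 1 + 1) / (x + 1) - 1) + x * (x / (x + 1) - 1) ≤ 1 := by
      have : (x + 1 + 1) * ((x + 1 + 1) / (x + 1) - 1) + x * (x / (x + 1) - 1)
          = 2 / (x + 1) := by field_simp; ring
      rw [this, div_le_one (by positivity)]
      linarith
    linarith

theorem deriv_deriv_fOne (z : ℝ) :
    deriv (deriv fOne) z = -poissonMean mulLogSecondDiff z := by
  have hb := abs_natCast_mul_log_le
  have h0 : fOne = -poissonMean (fun j : ℕ => (j : ℝ) * Real.log (j : ℝ)) :=
    funext fun _ => rfl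
  have h1 : deriv fOne = -poissonMean (fun j : ℕ =>
      ((j + 1 : ℕ) : ℝ) * Real.log ((j + 1 : ℕ) : ℝ) - (j : ℝ) * Real.log (j : ℝ)) := by
    rw [h0]
    exact funext fun z => (hasDerivAt_poissonMean hb z).neg.deriv
  rw [h1]
  refine (hasDerivAt_poissonMean (C := 5) (r := 4) (fun j => ?_) z).neg.deriv
  calc _ ≤ _ := abs_sub _ _
    _ ≤ 1 * 4 ^ (j + 1) + 1 * 4 ^ j := add_le_add (hb _) (hb _)
    _ = 5 * 4 ^ j := by ring

theorem stmt_4 (z : ℝ) (hz : 0 ≤ z) :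
    -Real.log 4 ≤ deriv (deriv fOne) z ∧ deriv (deriv fOne) z < 0 := by
  have hs : Summable fun j : ℕ => z ^ j / (j.factorial : ℝ) * mulLogSecondDiff j :=
    summable_pow_div_factorial_mul (C := Real.log 4) (r := 1)
      (fun j => by
        rw [abs_of_pos (mulLogSecondDiff_pos j), one_pow, mul_one]
        exact mulLogSecondDiff_le j) z
  rw [deriv_deriv_fOne, neg_le_neg_iff, neg_lt_zero, poissonMean]
  constructor
  · calc Real.exp (-z) * ∑' j : ℕ, z ^ j / (j.factorial : ℝ) * mulLogSecondDiff j
        ≤ Real.exp (-z) * ∑' j : ℕ, z ^ j / (j.factorial : ℝ) * Real.log 4 := by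
          refine mul_le_mul_of_nonneg_left (hs.tsum_le_tsum (fun j => ?_)
            ((Real.summable_pow_div_factorial z).mul_right _)) (Real.exp_pos _).le
          exact mul_le_mul_of_nonneg_left (mulLogSecondDiff_le j) (by positivity)
      _ = Real.log 4 := by
          rw [tsum_mul_right, ← congrFun NormedSpace.exp_eq_tsum_div z, ← Real.exp_eq_exp_ℝ,
            ← mul_assoc, ← Real.exp_add, neg_add_cancel, Real.exp_zero, one_mul]
  · refine mul_pos (Real.exp_pos _) (hs.tsum_pos (fun j => ?_) 0 ?_)
    · exact mul_nonneg (by positivity) (mulLogSecondDiff_pos j).le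
    · simpa using mulLogSecondDiff_pos 0
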